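/- arXiv:2210.08629 — 2 statements merged into one kernel-verified Lean document; each statement's English description precedes it below -/
import Mathlib

section
/- For every k > 1 and every 1 ≤ ℓ ≤ k−1, the ℓ-Rauzy graph of order k for the infinite Fibonacci word, ℓ-R_f(k), is strongly connected: for every ordered pair of vertices (u,v) there is a directed path in ℓ-R_f(k) from u to v. -/
noncomputable section

/-- τ = (√5 − 1)/2. -/
def tau : ℝ := (Real.sqrt 5 - 1) / 2

/-- The infinite Fibonacci word: the n-th letter (n ≥ 1) is 1 if ⌊(n+1)τ⌋ = ⌊nτ⌋ and 0 otherwise. -/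
def fibWord (n : ℕ) : ℕ :=
  if ⌊((n : ℝ) + 1) * tau⌋ = ⌊(n : ℝ) * tau⌋ then 1 else 0

/-- f[i;k] : the factor f_i f_{i+1} ⋯ f_{i+k-1}. -/
def fibFactor (i k : ℕ) : List ℕ :=
  (List.range k).map fun j => fibWord (i + j)

/-- L_f(k) : the set of factors of the infinite Fibonacci word of length k. -/
def fibFactors (k : ℕ) : Set (List ℕ) :=
  { x | ∃ i, 1 ≤ i ∧ x = fibFactor i k }

/-- (u,v) is an arc of the ℓ-Rauzy graph ℓ-R_f(k): u,v are vertices,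
the suffix of u of length ℓ equals the prefix of v of length ℓ, and
u₁⋯u_k v_{ℓ+1}⋯v_k ∈ L_f(2k−ℓ). -/
def lArc (k l : ℕ) (u v : List ℕ) : Prop :=
  u ∈ fibFactors k ∧ v ∈ fibFactors k ∧
    u.drop (k - l) = v.take l ∧ (u ++ v.drop l) ∈ fibFactors (2 * k - l)

/-- Finitely many floors are simultaneously unchanged under small nonnegative shifts. -/
lemma exists_floor_add_eq {ι : Type*} (s : Finset ι) (x : ι → ℝ) :
    ∃ ε > 0, ∀ δ, 0 ≤ δ → δ < ε → ∀ t ∈ s, ⌊x t + δ⌋ = ⌊x t⌋ := by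
  induction s using Finset.cons_induction with
  | empty => exact ⟨1, one_pos, by simp⟩
  | cons a s ha ih =>
    obtain ⟨ε, hε, h⟩ := ih
    refine ⟨min ε (1 - Int.fract (x a)), lt_min hε (by linarith [Int.fract_lt_one (x a)]), ?_⟩
    intro δ h0 hδ t ht
    rw [lt_min_iff] at hδ
    rcases Finset.mem_cons.1 ht with rfl | ht
    · rw [Int.floor_eq_iff]
      have := Int.self_sub_floor (x t)
      constructor <;> linarith [Int.floor_le (x t)]
    · exact h δ h0 hδ.1 t ht

/-- The nonnegative multiples of an irrational number are dense modulo one. -/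
lemma Irrational.exists_nat_mul_sub_int_mem_Ioo {a : ℝ} (ha : Irrational a) {b c : ℝ}
    (hbc : b < c) : ∃ (j : ℕ) (N : ℤ), (j : ℝ) * a - N ∈ Set.Ioo b c := by
  have hd : DenseRange (· • (a : AddCircle (1 : ℝ)) : ℕ → AddCircle (1 : ℝ)) :=
    denseRange_zsmul_iff_nsmul.1 (AddCircle.denseRange_zsmul_coe_iff.2 (by simpa using ha))
  have ho : IsOpen ((fun x : ℝ => (x : AddCircle (1 : ℝ))) '' Set.Ioo b c) :=
    QuotientAddGroup.isOpenMap_coe _ isOpen_Ioo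
  obtain ⟨j, x, hx, hj⟩ := hd.exists_mem_open ho ((Set.nonempty_Ioo.2 hbc).image _)
  have hj' : ((j * a - x : ℝ) : AddCircle (1 : ℝ)) = 0 := by
    rw [AddCircle.coe_sub, ← nsmul_eq_mul, AddCircle.coe_nsmul, sub_eq_zero]
    exact hj.symm
  obtain ⟨N, hN⟩ := (AddCircle.coe_eq_zero_iff _).1 hj'
  rw [zsmul_one] at hN
  exact ⟨j, N, by rwa [hN, sub_sub_cancel]⟩

lemma irrational_tau : Irrational tau := by
  have h := Nat.prime_five.irrational_sqrt
  simpa [tau] using (h.sub_intCast 1).div_natCast (m := 2) (by norm_num)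

/-- Every factor recurs along every arithmetic progression of positions. -/
lemma exists_fibFactor_add_mul_eq (i i' k : ℕ) {m : ℕ} (hm : m ≠ 0) :
    ∃ j, fibFactor (i + j * m) k = fibFactor i' k := by
  obtain ⟨ε, hε, h⟩ := exists_floor_add_eq (Finset.range (k + 1))
    fun t : ℕ => ((i' : ℝ) + t) * tau
  obtain ⟨j, N, hj⟩ := (irrational_tau.natCast_mul hm).exists_nat_mul_sub_int_mem_Ioo
    (lt_add_of_pos_right (((i' : ℝ) - i) * tau) hε)
  have key : ∀ t ≤ k, ⌊((i : ℝ) + j * m + t) * tau⌋ = ⌊((i' : ℝ) + t) * tau⌋ + N := by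
    intro t ht
    rw [← h (j * (m * tau) - N - (i' - i) * tau) (by linarith [hj.1]) (by linarith [hj.2]) t
      (by simpa [Nat.lt_succ_iff] using ht), ← Int.floor_add_intCast]
    congr 1
    ring
  refine ⟨j, List.map_congr_left fun t ht => ?_⟩
  rw [List.mem_range] at ht
  have h0 := key t ht.le
  have h1 := key (t + 1) ht
  push_cast at h1
  simp only [← add_assoc] at h1
  simp [fibWord, h0, h1]

lemma lArc_fibFactor {a k l : ℕ} (ha : 1 ≤ a) (hl : l ≤ k) :
    lArc k l (fibFactor a k) (fibFactor (a + (k - l)) k) := by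
  refine ⟨⟨a, ha, rfl⟩, ⟨a + (k - l), by omega, rfl⟩, ?_, a, ha, ?_⟩
  · apply List.ext_getElem
    · simp [fibFactor]; omega
    · intro n h1 h2
      simp [fibFactor, add_assoc]
  · apply List.ext_getElem
    · simp [fibFactor]; omega
    · intro n h1 h2
      simp only [fibFactor, List.getElem_append, List.length_map, List.length_range,
        List.getElem_map, List.getElem_range, List.getElem_drop]
      split_ifs
      · rfl
      · congr 1; omega

/-- The ℓ-Rauzy graph ℓ-R_f(k) of the infinite Fibonacci word is strongly connected:
for every ordered pair of vertices (u,v) there is a directed path from u to v. -/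
theorem fib_lRauzy_strongly_connected (k l : ℕ) (hk : 1 < k) (hl1 : 1 ≤ l) (hl2 : l ≤ k - 1) :
    ∀ u ∈ fibFactors k, ∀ v ∈ fibFactors k,
      ∃ p : List (List ℕ), p ≠ [] ∧ p.head? = some u ∧ p.getLast? = some v ∧
        p.Chain' (lArc k l) := by
  rintro _ ⟨i, hi, rfl⟩ _ ⟨i', -, rfl⟩
  obtain ⟨j, hj⟩ := exists_fibFactor_add_mul_eq i i' k (m := k - l) (by omega)
  refine ⟨(List.range (j + 1)).map fun s => fibFactor (i + s * (k - l)) k, by simp,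
    by simp [List.head?_range], by simp [List.getLast?_range, hj], ?_⟩
  refine (List.isChain_map _).2 ((List.isChain_range _ _).2 fun s _ => ?_)
  rw [Nat.succ_mul, ← add_assoc]
  exact lArc_fibFactor (by omega) (by omega)
end
end

section
/- Let n ≥ 3, let k = F_{n+1} − 1, and let 1 ≤ ℓ ≤ k−1 be such that k−ℓ < F_{n−1} and 2(k−ℓ) < F_n. Then no vertex v of the ℓ-Rauzy graph ℓ-R_f(k) of the infinite Fibonacci word satisfies both indegree(v) = 2 and outdegree(v) = 2. -/
noncomputable section

/-- Fibonacci numbers: F₀ = F₁ = 1, F_{n} = F_{n−1} + F_{n−2}. -/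
def fibF : ℕ → ℕ
  | 0 => 1
  | 1 => 1
  | n + 2 => fibF (n + 1) + fibF n

/-- The indexing v_j of the k+1 factors of length k of f (F_n ≤ k ≤ F_{n+1}):
v_j = f[j;k] for 1 ≤ j ≤ F_n and v_j = f[j + F_{n+1} − (k+1); k] for F_n+1 ≤ j ≤ k+1. -/
def vfac (n k j : ℕ) : List ℕ :=
  if j ≤ fibF n then fibFactor j k else fibFactor (j + fibF (n + 1) - (k + 1)) k

theorem tau_sq : tau ^ 2 = 1 - tau := by
  have h : Real.sqrt 5 ^ 2 = 5 := Real.sq_sqrt (by norm_num)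
  unfold tau
  linear_combination h / 4

theorem tau_pos : 0 < tau := by
  have h : Real.sqrt 5 ^ 2 = 5 := Real.sq_sqrt (by norm_num)
  unfold tau
  nlinarith [Real.sqrt_nonneg 5]

theorem tau_lt_one : tau < 1 := by
  nlinarith [tau_sq, tau_pos]

theorem tau_pow_add_two (r : ℕ) : tau ^ (r + 2) = tau ^ r - tau ^ (r + 1) := by
  linear_combination tau ^ r * tau_sq

theorem fibF_add_two (r : ℕ) : fibF (r + 2) = fibF (r + 1) + fibF r := rfl

theorem fibF_pos : ∀ n, 0 < fibF n
  | 0 => one_pos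
  | 1 => one_pos
  | n + 2 => Nat.add_pos_left (fibF_pos (n + 1)) _

/-- Both `F_r τ` and `F_{r+1} τ` are exponentially close to integers, on opposite sides. -/
theorem fibF_mul_tau (r : ℕ) :
    (fibF r : ℝ) * tau = fibF (r + 1) - fibF r + (-1) ^ r * tau ^ (r + 1) ∧
      (fibF (r + 1) : ℝ) * tau = fibF r - (-1) ^ r * tau ^ (r + 2) := by
  induction r with
  | zero => simp [fibF, tau_sq]
  | succ r ih =>
    obtain ⟨h₀, h₁⟩ := ih
    rw [fibF_add_two r]
    push_cast
    constructor
    · linear_combination h₁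
    · linear_combination h₀ + h₁ - (-1) ^ r * tau_pow_add_two (r + 1)

/-- The convergents of `τ` give a basis of `ℤ²`. -/
theorem exists_fibF_coords (r : ℕ) (s p : ℤ) :
    ∃ u v : ℤ, s = u * fibF r + v * fibF (r + 1) ∧
      (s : ℝ) * tau - p = (-1) ^ r * (u * tau ^ (r + 1) - v * tau ^ (r + 2)) := by
  induction r with
  | zero =>
    refine ⟨s - p, p, by simp [fibF], ?_⟩
    push_cast
    linear_combination (p : ℝ) * tau_sq
  | succ r ih =>
    obtain ⟨u, v, hs, hp⟩ := ih
    refine ⟨v - u, u, ?_, ?_⟩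
    · rw [hs, fibF_add_two]
      push_cast
      ring
    · rw [hp]
      push_cast
      linear_combination -(-1) ^ r * (u : ℝ) * tau_pow_add_two (r + 1)

/-- Best approximation property of the convergents of `τ`. -/
theorem tau_pow_le_abs_mul_tau_sub (r : ℕ) (s p : ℤ) (hs : 0 < s) (hs' : s < fibF (r + 1)) :
    tau ^ (r + 1) ≤ |(s : ℝ) * tau - p| := by
  obtain ⟨u, v, h, hp⟩ := exists_fibF_coords r s p
  rw [hp, abs_mul, abs_pow, abs_neg, abs_one, one_pow, one_mul]
  have h₁ : 0 < tau ^ (r + 1) := pow_pos tau_pos _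
  have h₂ : 0 < tau ^ (r + 2) := pow_pos tau_pos _
  have hF : (0 : ℤ) ≤ fibF r := Int.natCast_nonneg _
  rcases lt_trichotomy u 0 with hu | rfl | hu
  · have hv : 0 ≤ v := by
      by_contra! hv
      nlinarith
    have hu' : (u : ℝ) ≤ -1 := by exact_mod_cast (by omega : u ≤ -1)
    have hv' : (0 : ℝ) ≤ v := by exact_mod_cast hv
    exact le_abs.2 (Or.inr (by nlinarith))
  · have hv : 0 < v := by
      by_contra! hv
      nlinarith
    nlinarith
  · have hv : v ≤ 0 := by
      by_contra! hv
      nlinarith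
    have hu' : (1 : ℝ) ≤ u := by exact_mod_cast hu
    have hv' : (v : ℝ) ≤ 0 := by exact_mod_cast hv
    exact le_abs.2 (Or.inl (by nlinarith))

/-- The points `-(F_{r+2} + a) τ` and `j τ` of the circle are separated by some `-m τ` with
`m < F_{r+2}`. -/
theorem exists_floor_ne (r a j : ℕ) (N P : ℤ) (hj : 1 ≤ j) (haj : a + j < fibF (r + 1)) :
    ∃ m < fibF (r + 2), ⌊(N - (fibF (r + 2) + a : ℕ) * tau) + m * tau⌋ ≠
      ⌊(P + j * tau) + m * tau⌋ := by
  by_contra! H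
  have hA := H a (by rw [fibF_add_two]; omega)
  have hB := H (a + fibF r) (by rw [fibF_add_two]; omega)
  obtain ⟨e₀, e₁⟩ := fibF_mul_tau r
  have e₂ := (fibF_mul_tau (r + 1)).2
  have t₁ : tau ^ (r + 3) = tau ^ (r + 1) - tau ^ (r + 2) := tau_pow_add_two (r + 1)
  have p₁ : 0 < tau ^ (r + 1) := pow_pos tau_pos _
  have p₂ : 0 < tau ^ (r + 2) := pow_pos tau_pos _
  have p₃ : 0 < tau ^ (r + 3) := pow_pos tau_pos _
  have l₁ : tau ^ (r + 1) < 1 := pow_lt_one₀ tau_pos.le tau_lt_one (by omega)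
  have l₂ : tau ^ (r + 2) < 1 := pow_lt_one₀ tau_pos.le tau_lt_one (by omega)
  have l₃ : tau ^ (r + 3) < 1 := pow_lt_one₀ tau_pos.le tau_lt_one (by omega)
  set Q : ℤ := N - fibF (r + 1) with hQ
  have hQ' : (Q : ℝ) = N - fibF (r + 1) := by simp [hQ]
  set W : ℝ := P + (j + a) * tau with hW
  have best : tau ^ (r + 1) ≤ |W - Q| := by
    have := tau_pow_le_abs_mul_tau_sub r (a + j) (Q - P) (by omega) (by omega)
    convert this using 2
    rw [hW]
    push_cast
    ring
  have eA₁ : N - (fibF (r + 2) + a : ℕ) * tau + a * tau = Q - (-1) ^ r * tau ^ (r + 3) := by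
    push_cast
    rw [hQ']
    linear_combination -e₂
  have eA₂ : P + j * tau + a * tau = W := by rw [hW]; ring
  have eB₁ : N - (fibF (r + 2) + a : ℕ) * tau + (a + fibF r : ℕ) * tau =
      Q + (-1) ^ r * tau ^ (r + 2) + (fibF (r + 1) - fibF r : ℤ) := by
    push_cast
    rw [hQ']
    linear_combination e₀ - e₂ - (-1) ^ r * t₁
  have eB₂ : P + j * tau + (a + fibF r : ℕ) * tau =
      W + (-1) ^ r * tau ^ (r + 1) + (fibF (r + 1) - fibF r : ℤ) := by
    push_cast
    rw [hW]
    linear_combination e₀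
  rw [eA₁, eA₂] at hA
  rw [eB₁, eB₂, Int.floor_add_intCast, Int.floor_add_intCast, add_left_inj] at hB
  rcases neg_one_pow_eq_or ℝ r with hr | hr
  · rw [hr] at hA hB
    have f₁ : ⌊(Q : ℝ) - 1 * tau ^ (r + 3)⌋ = Q - 1 := by
      rw [Int.floor_eq_iff]
      push_cast
      constructor <;> linarith
    have f₂ : ⌊(Q : ℝ) + 1 * tau ^ (r + 2)⌋ = Q := by
      rw [Int.floor_eq_iff]
      constructor <;> linarith
    have g₁ := (Int.floor_eq_iff.1 (hA.symm.trans f₁)).2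
    have g₂ := (Int.floor_eq_iff.1 (hB.symm.trans f₂)).1
    push_cast at g₁
    have hWQ : W - Q = -tau ^ (r + 1) := by
      rcases le_abs.1 best with h | h <;> linarith
    have := tau_pow_le_abs_mul_tau_sub (r + 1) (a + j + fibF r)
      (Q - P + fibF (r + 1) - fibF r) (by omega) (by rw [fibF_add_two]; push_cast; omega)
    have hz : ((a + j + fibF r : ℤ) : ℝ) * tau - (Q - P + fibF (r + 1) - fibF r : ℤ) = 0 := by
      rw [hr] at e₀
      push_cast
      linear_combination hWQ + e₀ - hW
    rw [hz, abs_zero] at this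
    exact absurd this (not_le.2 p₂)
  · rw [hr] at hA hB
    have f₁ : ⌊(Q : ℝ) - -1 * tau ^ (r + 3)⌋ = Q := by
      rw [Int.floor_eq_iff]
      constructor <;> linarith
    have f₂ : ⌊(Q : ℝ) + -1 * tau ^ (r + 2)⌋ = Q - 1 := by
      rw [Int.floor_eq_iff]
      push_cast
      constructor <;> linarith
    have g₁ := (Int.floor_eq_iff.1 (hA.symm.trans f₁)).1
    have g₂ := (Int.floor_eq_iff.1 (hB.symm.trans f₂)).2
    push_cast at g₂
    rcases le_abs.1 best with h | h <;> linarith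

/-- Two reals whose translates by `s` have different integer parts are separated by an integer
translate of `-s`. -/
theorem exists_int_between {x y s : ℝ} (h : ⌊x + s⌋ ≠ ⌊y + s⌋) :
    ∃ N : ℤ, min x y ≤ N - s ∧ N - s ≤ max x y := by
  wlog hxy : ⌊x + s⌋ < ⌊y + s⌋ generalizing x y
  · rw [min_comm, max_comm]
    exact this h.symm (lt_of_le_of_ne (not_lt.1 hxy) h.symm)
  refine ⟨⌊y + s⌋, min_le_of_left_le ?_, le_max_of_le_right ?_⟩
  · linarith [Int.floor_lt.1 hxy]
  · linarith [Int.floor_le (y + s)]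

theorem floor_add_eq_of_between {x y z s : ℝ} (h : ⌊x + s⌋ = ⌊y + s⌋) (hz : min x y ≤ z)
    (hz' : z ≤ max x y) : ⌊z + s⌋ = ⌊x + s⌋ := by
  rcases le_total x y with hxy | hxy
  · rw [min_eq_left hxy] at hz
    rw [max_eq_right hxy] at hz'
    exact le_antisymm (h ▸ Int.floor_mono (by linarith)) (Int.floor_mono (by linarith))
  · rw [min_eq_right hxy] at hz
    rw [max_eq_left hxy] at hz'
    exact le_antisymm (Int.floor_mono (by linarith)) (h ▸ Int.floor_mono (by linarith))

theorem floor_fract_add (x s : ℝ) : ⌊Int.fract x + s⌋ = ⌊x + s⌋ - ⌊x⌋ := by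
  rw [Int.fract, sub_add_eq_add_sub, Int.floor_sub_intCast]

theorem floor_fract_mul_tau_add (x m : ℕ) : ⌊Int.fract ((x : ℝ) * tau) + m * tau⌋ =
    ⌊((x + m : ℕ) : ℝ) * tau⌋ - ⌊(x : ℝ) * tau⌋ := by
  rw [floor_fract_add]
  push_cast
  ring_nf

theorem fibWord_cast (i : ℕ) :
    (fibWord i : ℤ) = 1 - (⌊((i + 1 : ℕ) : ℝ) * tau⌋ - ⌊(i : ℝ) * tau⌋) := by
  have h₁ : ⌊(i : ℝ) * tau⌋ ≤ ⌊((i : ℝ) + 1) * tau⌋ := Int.floor_mono (by nlinarith [tau_pos])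
  have h₂ : ⌊((i : ℝ) + 1) * tau⌋ ≤ ⌊(i : ℝ) * tau⌋ + 1 := by
    rw [← Int.floor_add_one]
    exact Int.floor_mono (by nlinarith [tau_lt_one])
  unfold fibWord
  push_cast
  split_ifs with h <;> omega

theorem fibFactor_eq_iff_fibWord (i i' k : ℕ) :
    fibFactor i k = fibFactor i' k ↔ ∀ m < k, fibWord (i + m) = fibWord (i' + m) := by
  simp [fibFactor]

theorem fibFactor_eq_iff (i i' k : ℕ) :
    fibFactor i k = fibFactor i' k ↔
      ∀ m ≤ k, ⌊((i + m : ℕ) : ℝ) * tau⌋ - ⌊(i : ℝ) * tau⌋ =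
        ⌊((i' + m : ℕ) : ℝ) * tau⌋ - ⌊(i' : ℝ) * tau⌋ := by
  rw [fibFactor_eq_iff_fibWord]
  constructor
  · intro h m hm
    induction m with
    | zero => simp
    | succ m ih =>
      have h₁ := fibWord_cast (i + m)
      have h₂ := fibWord_cast (i' + m)
      rw [h m hm] at h₁
      have := ih (by omega)
      simp only [← add_assoc]
      omega
  · intro h m hm
    have h₁ := fibWord_cast (i + m)
    have h₂ := fibWord_cast (i' + m)
    have h₃ := h m hm.le
    have h₄ := h (m + 1) hm
    simp only [← add_assoc] at h₄
    omega

theorem floor_fract_eq_of_fibFactor_eq {i i' k : ℕ} (h : fibFactor i k = fibFactor i' k)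
    (m : ℕ) (hm : m ≤ k) :
    ⌊Int.fract ((i : ℝ) * tau) + m * tau⌋ = ⌊Int.fract ((i' : ℝ) * tau) + m * tau⌋ := by
  rw [floor_fract_mul_tau_add, floor_fract_mul_tau_add]
  exact (fibFactor_eq_iff _ _ _).1 h m hm

theorem fibFactor_drop (i k d : ℕ) : (fibFactor i (k + d)).drop d = fibFactor (i + d) k := by
  apply List.ext_getElem <;> simp [fibFactor, add_assoc]

theorem fibFactor_take (i k d : ℕ) : (fibFactor i (k + d)).take k = fibFactor i k := by
  apply List.ext_getElem <;> simp [fibFactor]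

/-- An arc of the graph is an occurrence of a factor of length `2k - l`. -/
theorem lArc.exists_eq_fibFactor {k l : ℕ} {u v : List ℕ} (hl : l ≤ k) (h : lArc k l u v) :
    ∃ p, u = fibFactor p k ∧ v = fibFactor (p + (k - l)) k := by
  obtain ⟨⟨i, -, hi⟩, -, hd, p, -, hp⟩ := h
  have hu : u.length = k := by simp [hi, fibFactor]
  rw [show 2 * k - l = k + (k - l) by omega] at hp
  refine ⟨p, ?_, ?_⟩
  · rw [← fibFactor_take p k (k - l), ← hp, List.take_left' hu]
  · rw [← fibFactor_drop p k (k - l), ← hp, List.drop_append_of_le_length (by omega), hd,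
      List.take_append_drop]

/-- Two different right extensions of a factor are separated by a point `-(k + 1 + a) τ`. -/
theorem exists_right_separation {k d q₁ q₂ : ℕ} (hd : d ≤ k)
    (hv : fibFactor q₁ k = fibFactor q₂ k)
    (hu : fibFactor (q₁ + d) k ≠ fibFactor (q₂ + d) k) :
    ∃ a < d, ∃ N : ℤ, ∀ m ≤ k,
      ⌊(N - (k + 1 + a : ℕ) * tau) + m * tau⌋ = ⌊Int.fract (q₁ * tau) + m * tau⌋ := by
  rw [fibFactor_eq_iff] at hv
  rw [Ne, fibFactor_eq_iff] at hu
  push Not at hu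
  obtain ⟨m, hm, hne⟩ := hu
  have hdv := hv d hd
  have hkm : k < d + m := by
    by_contra! hle
    have := hv (d + m) hle
    simp only [← add_assoc] at this
    omega
  have hsep : ⌊Int.fract (q₁ * tau) + (d + m : ℕ) * tau⌋ ≠
      ⌊Int.fract (q₂ * tau) + (d + m : ℕ) * tau⌋ := by
    rw [floor_fract_mul_tau_add, floor_fract_mul_tau_add]
    simp only [← add_assoc]
    omega
  obtain ⟨N, hN, hN'⟩ := exists_int_between hsep
  refine ⟨d + m - (k + 1), by omega, N, fun t ht => ?_⟩
  rw [show k + 1 + (d + m - (k + 1)) = d + m by omega]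
  exact floor_add_eq_of_between
      (by rw [floor_fract_mul_tau_add, floor_fract_mul_tau_add]; exact hv t ht) hN hN'

/-- Two different left extensions of a factor are separated by a point `j τ`. -/
theorem exists_left_separation {k d p₁ p₂ : ℕ}
    (hv : fibFactor (p₁ + d) k = fibFactor (p₂ + d) k)
    (hu : fibFactor p₁ k ≠ fibFactor p₂ k) :
    ∃ j, 1 ≤ j ∧ j ≤ d ∧ ∃ P : ℤ, ∀ m ≤ k,
      ⌊(P + j * tau) + m * tau⌋ = ⌊Int.fract ((p₁ + d : ℕ) * tau) + m * tau⌋ := by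
  rw [fibFactor_eq_iff] at hv
  obtain ⟨j, hjd, hj⟩ : ∃ j ≤ d, ⌊((p₁ + (d - j) : ℕ) : ℝ) * tau⌋ - ⌊((p₁ + d : ℕ) : ℝ) * tau⌋ ≠
      ⌊((p₂ + (d - j) : ℕ) : ℝ) * tau⌋ - ⌊((p₂ + d : ℕ) : ℝ) * tau⌋ := by
    by_contra! H
    refine hu ((fibFactor_eq_iff _ _ _).2 fun m hm => ?_)
    have h₀ := H d le_rfl
    simp only [Nat.sub_self, add_zero] at h₀
    rcases le_total m d with hmd | hmd
    · have h₁ := H (d - m) (by omega)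
      rw [Nat.sub_sub_self hmd] at h₁
      omega
    · have h₁ := hv (m - d) (by omega)
      simp only [add_assoc, Nat.add_sub_cancel' hmd] at h₁
      omega
  have hback (x : ℕ) : ⌊Int.fract (((x + d : ℕ) : ℝ) * tau) + -(j * tau)⌋ =
      ⌊((x + (d - j) : ℕ) : ℝ) * tau⌋ - ⌊((x + d : ℕ) : ℝ) * tau⌋ := by
    rw [floor_fract_add]
    push_cast [Nat.cast_sub hjd]
    ring_nf
  obtain ⟨P, hP, hP'⟩ := exists_int_between (by rwa [hback, hback] :
    ⌊Int.fract (((p₁ + d : ℕ) : ℝ) * tau) + -(j * tau)⌋ ≠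
      ⌊Int.fract (((p₂ + d : ℕ) : ℝ) * tau) + -(j * tau)⌋)
  rw [sub_neg_eq_add] at hP hP'
  refine ⟨j, ?_, hjd, P, fun m hm => ?_⟩
  · by_contra! h
    simp [Nat.lt_one_iff.1 h] at hj
  · exact floor_add_eq_of_between
      (by rw [floor_fract_mul_tau_add, floor_fract_mul_tau_add]; exact hv m hm) hP hP'

/-- For k = F_{n+1} − 1 with k−ℓ < F_{n−1} and 2(k−ℓ) < F_n, no vertex of ℓ-R_f(k)
has both indegree 2 and outdegree 2. -/
theorem fib_no_degree_two_two (n k l : ℕ) (hn : 3 ≤ n) (hk : k = fibF (n + 1) - 1)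
    (hl1 : 1 ≤ l) (hl2 : l ≤ k - 1)
    (h1 : k - l < fibF (n - 1)) (h2 : 2 * (k - l) < fibF n) :
    ∀ v ∈ fibFactors k,
      ¬ ({u | lArc k l u v}.ncard = 2 ∧ {u | lArc k l v u}.ncard = 2) := by
  intro v _ ⟨hin, hout⟩
  obtain ⟨u₁, u₂, hu, hset⟩ := Set.ncard_eq_two.1 hin
  obtain ⟨w₁, w₂, hw, hset'⟩ := Set.ncard_eq_two.1 hout
  have arc_in (u) (h : u ∈ ({u₁, u₂} : Set (List ℕ))) : lArc k l u v := by rwa [← hset] at h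
  have arc_out (w) (h : w ∈ ({w₁, w₂} : Set (List ℕ))) : lArc k l v w := by rwa [← hset'] at h
  have hlk : l ≤ k := by omega
  obtain ⟨p₁, rfl, hp₁⟩ := (arc_in u₁ (by simp)).exists_eq_fibFactor hlk
  obtain ⟨p₂, rfl, hp₂⟩ := (arc_in u₂ (by simp)).exists_eq_fibFactor hlk
  obtain ⟨q₁, hq₁, rfl⟩ := (arc_out w₁ (by simp)).exists_eq_fibFactor hlk
  obtain ⟨q₂, hq₂, rfl⟩ := (arc_out w₂ (by simp)).exists_eq_fibFactor hlk
  obtain ⟨a, ha, N, hN⟩ := exists_right_separation (Nat.sub_le k l) (hq₁.symm.trans hq₂) hw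
  obtain ⟨j, hj, hjd, P, hP⟩ := exists_left_separation (hp₁.symm.trans hp₂) hu
  obtain ⟨r, rfl⟩ : ∃ r, n = r + 1 := ⟨n - 1, by omega⟩
  have hk1 : k + 1 = fibF (r + 2) := by
    rw [hk, Nat.sub_add_cancel (fibF_pos _)]
  obtain ⟨m, hm, hne⟩ := exists_floor_ne r a j N P hj (by omega)
  rw [← hk1] at hm hne
  have hmk : m ≤ k := by omega
  exact hne ((hN m hmk).trans
    ((floor_fract_eq_of_fibFactor_eq (hq₁.symm.trans hp₁) m hmk).trans (hP m hmk).symm))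
end
end
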